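/- Fix nonnegative integers n and W. The map sending a partition λ with |λ| = W, at most n parts, and each part of size at most d − 1, written multiplicatively as [1]^{m_1}⋯[d−1]^{m_{d−1}} (where m_i is the number of parts of λ equal to i), to g_1^{n − Σ_{i=1}^{d−1} m_i} ∘ g_2^{m_1} ∘ ⋯ ∘ g_d^{m_{d−1}}(0,…,0) ∈ ℕ^d, is a bijection onto the set {x ∈ ℕ^d : n(x) = n and W(x) = W}. -/

import Mathlib

namespace Spiral

/-- The size `n(x) = n₁ + ⋯ + n_d` of a configuration `x ∈ ℕ^d`. -/
def size {d : ℕ} (x : Fin d → ℕ) : ℕ := ∑ i, x i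

/-- The weight `W(x) = Σ_{i<j} (max(0, x_j − x_i) + max(0, x_i − x_j − 1))`
(truncated ℕ-subtraction realizes the `max(0,·)`). -/
def weight {d : ℕ} (x : Fin d → ℕ) : ℕ :=
  ∑ i : Fin d, ∑ j : Fin d, if i < j then (x j - x i) + (x i - x j - 1) else 0

/-- The configuration `x` as a set of points of `[d] × ℕ`: the point `(i, n)` (seat `i`
0-indexed, level `n`) is encoded as the natural number `n*d + i`. The usual order on the
encodings is exactly the height order `≺` (height `h(i,n) = n + i/d`), and the spiral
shift `δ + s/d` is encoded as `+ s`. -/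
def pts (d : ℕ) (x : Fin d → ℕ) : Finset ℕ :=
  Finset.image (fun i : Fin d => x i * d + i.val) Finset.univ

/-- The points of `x` listed in increasing height order: `δ¹(x), …, δ^d(x)`. -/
def sortedPts (d : ℕ) (x : Fin d → ℕ) : List ℕ :=
  (pts d x).sort (· ≤ ·)

/-- The lowest point strictly above `p` (along the spiral) whose seat lies in `S`. -/
noncomputable def nextPt (d : ℕ) (S : Finset ℕ) (p : ℕ) : ℕ :=
  sInf {q : ℕ | p < q ∧ q % d ∈ S}

/-- The spiral shifting operator `g_j` (for `1 ≤ j ≤ d`): it fixes the lowest `j - 1`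
points `δ¹(x), …, δ^{j-1}(x)` and moves each remaining point `δ^k(x)` (`k ≥ j`) to
`δ^k(x) + s_k/d`, where `s_k` is the minimal positive integer such that the seat of
`δ^k(x) + s_k/d` lies in `{i(δ^j(x)), …, i(δ^d(x))}`. The resulting configuration is read
off from the new point set (which has exactly one point per seat). -/
noncomputable def gOp (d : ℕ) (j : ℕ) (x : Fin d → ℕ) : Fin d → ℕ := fun i =>
  let L := sortedPts d x
  let low := L.take (j - 1)
  let high := L.drop (j - 1)
  let S : Finset ℕ := high.toFinset.image (· % d)
  let Q : Finset ℕ := low.toFinset ∪ (high.map (nextPt d S)).toFinset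
  ∑ q ∈ Q.filter (fun q => q % d = i.val), q / d

/-- `g^a := g₁^{a₁} ∘ ⋯ ∘ g_d^{a_d}` (here `a i` is the exponent of `g_{i+1}`). -/
noncomputable def gIter (d : ℕ) (a : Fin d → ℕ) (x : Fin d → ℕ) : Fin d → ℕ :=
  (List.finRange d).foldr (fun j y => (gOp d (j.val + 1))^[a j] y) x

end Spiral

namespace Spiral

/-- Spiral translation. -/
def rotT {d : ℕ} (x : Fin (d+1) → ℕ) : Fin (d+1) → ℕ :=
  Fin.cons (x (Fin.last d) + 1) (fun i => x i.castSucc)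

lemma mem_pts {d : ℕ} {x : Fin d → ℕ} {q : ℕ} :
    q ∈ pts d x ↔ ∃ i : Fin d, x i * d + i.val = q := by
  simp [pts]

lemma code_div {d : ℕ} (i : Fin d) (m : ℕ) : (m * d + i.val) / d = m := by
  have h : 0 < d := i.pos
  rw [mul_comm, Nat.mul_add_div h, Nat.div_eq_of_lt i.2, add_zero]

lemma code_mod {d : ℕ} (i : Fin d) (m : ℕ) : (m * d + i.val) % d = i.val := by
  rw [mul_comm, Nat.mul_add_mod, Nat.mod_eq_of_lt i.2]

lemma sum_filter_pts {d : ℕ} (x : Fin d → ℕ) (i : Fin d) :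
    ∑ q ∈ (pts d x).filter (fun q => q % d = i.val), q / d = x i := by
  have : (pts d x).filter (fun q => q % d = i.val) = {x i * d + i.val} := by
    ext q
    simp only [Finset.mem_filter, mem_pts, Finset.mem_singleton]
    constructor
    · rintro ⟨⟨k, rfl⟩, h⟩
      rw [code_mod] at h
      rw [Fin.ext h]
    · rintro rfl
      exact ⟨⟨i, rfl⟩, code_mod _ _⟩
  rw [this, Finset.sum_singleton, code_div]

lemma mem_sortedPts {d : ℕ} {x : Fin d → ℕ} {q : ℕ} :
    q ∈ sortedPts d x ↔ q ∈ pts d x := by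
  simp [sortedPts]

lemma nextPt_full {d : ℕ} (S : Finset ℕ) (hS : ∀ k, k < d + 1 → k ∈ S) (p : ℕ) :
    nextPt (d+1) S p = p + 1 := by
  apply IsLeast.csInf_eq
  refine ⟨⟨Nat.lt_succ_self p, hS _ (Nat.mod_lt _ (Nat.succ_pos d))⟩, ?_⟩
  rintro q ⟨h, -⟩
  exact h

lemma pts_rotT {d : ℕ} (x : Fin (d+1) → ℕ) :
    pts (d+1) (rotT x) = (pts (d+1) x).image (· + 1) := by
  ext q
  simp only [mem_pts, Finset.mem_image, exists_exists_eq_and]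
  rw [Fin.exists_fin_succ]
  conv_rhs => rw [Fin.exists_fin_succ']
  simp only [rotT, Fin.cons_zero, Fin.cons_succ, Fin.val_zero, Fin.val_succ, Fin.val_castSucc,
    Fin.val_last]
  rw [or_comm]
  apply or_congr
  · simp only [add_assoc]
  · rw [show (x (Fin.last d) + 1) * (d+1) + 0 = x (Fin.last d) * (d+1) + d + 1 by ring]

lemma gOp_one {d : ℕ} (x : Fin (d+1) → ℕ) : gOp (d+1) 1 x = rotT x := by
  funext i
  unfold gOp
  simp only [Nat.sub_self, List.take_zero, List.drop_zero, List.toFinset_nil, Finset.empty_union]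
  have hS : ∀ k, k < d + 1 → k ∈ (sortedPts (d+1) x).toFinset.image (· % (d+1)) := by
    intro k hk
    rw [Finset.mem_image]
    refine ⟨x ⟨k, hk⟩ * (d+1) + k, ?_, code_mod (⟨k, hk⟩ : Fin (d+1)) _⟩
    rw [List.mem_toFinset, mem_sortedPts, mem_pts]
    exact ⟨⟨k, hk⟩, rfl⟩
  have hQ : ((sortedPts (d+1) x).map
      (nextPt (d+1) ((sortedPts (d+1) x).toFinset.image (· % (d+1))))).toFinset
      = pts (d+1) (rotT x) := by
    rw [pts_rotT]
    ext q
    simp only [List.mem_toFinset, List.mem_map, Finset.mem_image, mem_sortedPts,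
      nextPt_full _ hS]
  rw [hQ, sum_filter_pts]

/-- Relabelling: the natural numbers not divisible by `d+1`, in order. -/
def phi (d m : ℕ) : ℕ := m / d * (d+1) + m % d + 1

lemma phi_code {d : ℕ} (i : Fin d) (m : ℕ) : phi d (m * d + i.val) = m * (d+1) + i.val + 1 := by
  rw [phi, code_div, code_mod]

lemma phi_mod {d : ℕ} (hd : 0 < d) (m : ℕ) : phi d m % (d+1) = m % d + 1 := by
  have := Nat.mod_lt m hd
  rw [phi, add_assoc, mul_comm, Nat.mul_add_mod, Nat.mod_eq_of_lt (by omega)]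

lemma phi_div {d : ℕ} (hd : 0 < d) (m : ℕ) : phi d m / (d+1) = m / d := by
  have := Nat.mod_lt m hd
  rw [phi, add_assoc, mul_comm, Nat.mul_add_div (Nat.succ_pos d),
    Nat.div_eq_of_lt (Nat.succ_lt_succ this), add_zero]

lemma phi_eq (d m : ℕ) : phi d m = m + m / d + 1 := by
  have := Nat.div_add_mod m d
  have h2 : m / d * (d+1) = d * (m / d) + m / d := by ring
  unfold phi
  omega

lemma phi_strictMono (d : ℕ) : StrictMono (phi d) := by
  intro a b h
  have := Nat.div_le_div_right (c := d) h.le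
  rw [phi_eq, phi_eq]
  omega

lemma phi_surj {d : ℕ} (q : ℕ) (hq : q % (d+1) ≠ 0) : ∃ m, phi d m = q := by
  have h1 : q % (d+1) < d + 1 := Nat.mod_lt q (Nat.succ_pos d)
  have h3 := Nat.div_add_mod q (d+1)
  obtain ⟨k, hk⟩ := Nat.exists_eq_succ_of_ne_zero hq
  refine ⟨q / (d+1) * d + k, ?_⟩
  have := phi_code (⟨k, by omega⟩ : Fin d) (q / (d+1))
  simp only at this
  rw [this, mul_comm]
  omega

lemma nextPt_phi {d : ℕ} (hd : 0 < d) (S : Finset ℕ) (p : ℕ) (hp : p % d ∈ S) :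
    nextPt (d+1) (S.image (· + 1)) (phi d p) = phi d (nextPt d S p) := by
  have hne : {q : ℕ | p < q ∧ q % d ∈ S}.Nonempty := ⟨p + d, by omega, by simpa using hp⟩
  have hm := Nat.sInf_mem hne
  apply IsLeast.csInf_eq
  refine ⟨⟨phi_strictMono d hm.1, ?_⟩, ?_⟩
  · rw [phi_mod hd]
    exact Finset.mem_image_of_mem _ hm.2
  · rintro q ⟨h1, h2⟩
    obtain ⟨k, hk, hk2⟩ := Finset.mem_image.1 h2
    obtain ⟨m, rfl⟩ := phi_surj (d := d) q (by rw [← hk2]; exact Nat.succ_ne_zero k)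
    rw [phi_mod hd] at hk2
    apply (phi_strictMono d).monotone
    refine Nat.sInf_le ⟨(phi_strictMono d).lt_iff_lt.1 h1, ?_⟩
    have : k = m % d := by simpa using hk2
    exact this ▸ hk

lemma pts_cons {d : ℕ} (y : Fin d → ℕ) :
    pts (d+1) (Fin.cons 0 y) = insert 0 ((pts d y).image (phi d)) := by
  ext q
  simp only [mem_pts, Finset.mem_insert, Finset.mem_image, exists_exists_eq_and]
  rw [Fin.exists_fin_succ]
  simp only [Fin.cons_zero, Fin.cons_succ, Fin.val_zero, Fin.val_succ, phi_code, add_assoc]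
  apply or_congr
  · simp [eq_comm]
  · rfl

lemma sortedPts_cons {d : ℕ} (y : Fin d → ℕ) :
    sortedPts (d+1) (Fin.cons 0 y) = 0 :: (sortedPts d y).map (phi d) := by
  have hs : (0 :: (sortedPts d y).map (phi d)).SortedLT := by
    rw [List.sortedLT_iff_pairwise, List.pairwise_cons]
    constructor
    · intro a ha
      obtain ⟨b, -, rfl⟩ := List.mem_map.1 ha
      simp [phi]
    · rw [List.pairwise_map]
      have : (sortedPts d y).SortedLT := Finset.sortedLT_sort _
      exact this.pairwise.imp (fun h => phi_strictMono d h)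
  have : pts (d+1) (Fin.cons 0 y) = (0 :: (sortedPts d y).map (phi d)).toFinset := by
    rw [pts_cons]
    ext q
    simp [mem_sortedPts]
  rw [sortedPts, this]
  exact (List.toFinset_sort (r := (· ≤ ·)) (hs.nodup)).2 hs.sortedLE.pairwise

lemma gOp_cons {d : ℕ} (j : ℕ) (y : Fin d → ℕ) :
    gOp (d+1) (j+2) (Fin.cons 0 y) = Fin.cons 0 (gOp d (j+1) y) := by
  rcases Nat.eq_zero_or_pos d with rfl | hd
  · funext i
    fin_cases i
    simp [gOp, sortedPts, pts]
  set L := sortedPts d y with hL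
  set S : Finset ℕ := (L.drop j).toFinset.image (· % d) with hS
  set Q : Finset ℕ := (L.take j).toFinset ∪ ((L.drop j).map (nextPt d S)).toFinset with hQ
  have e1 : gOp d (j+1) y = fun i : Fin d => ∑ q ∈ Q.filter (fun q => q % d = i.val), q / d := by
    funext i
    simp only [gOp, Nat.add_sub_cancel, hQ, hS, hL]
  have hS' : (((L.drop j).map (phi d)).toFinset.image (· % (d+1))) = S.image (· + 1) := by
    ext q
    simp only [hS, Finset.mem_image, List.mem_toFinset, List.mem_map, exists_exists_and_eq_and,
      phi_mod hd]
  have e2 : gOp (d+1) (j+2) (Fin.cons 0 y) = fun i : Fin (d+1) =>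
      ∑ q ∈ (insert 0 (Q.image (phi d))).filter (fun q => q % (d+1) = i.val), q / (d+1) := by
    funext i
    simp only [gOp, show j + 2 - 1 = j + 1 by omega, sortedPts_cons, List.take_succ_cons,
      List.drop_succ_cons, ← hL, ← List.map_take, ← List.map_drop]
    rw [hS']
    congr 2
    rw [hQ]
    ext q
    simp only [Finset.mem_union, List.mem_toFinset, List.mem_cons, List.mem_map, Finset.mem_insert,
      Finset.mem_image, or_assoc, exists_exists_and_eq_and, or_and_right, exists_or]
    apply or_congr Iff.rfl
    apply or_congr Iff.rfl
    apply exists_congr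
    intro p
    apply and_congr_right
    intro hp
    rw [nextPt_phi hd]
    exact Finset.mem_image_of_mem _ (List.mem_toFinset.2 hp)
  rw [e1, e2]
  funext i
  refine Fin.cases ?_ (fun k => ?_) i
  · rw [Fin.cons_zero]
    apply Finset.sum_eq_zero
    intro q hq
    rw [Finset.mem_filter, Finset.mem_insert, Finset.mem_image] at hq
    obtain ⟨rfl | ⟨p, -, rfl⟩, h⟩ := hq
    · simp
    · rw [phi_mod hd] at h
      simp at h
  · rw [Fin.cons_succ]
    have : (insert 0 (Q.image (phi d))).filter (fun q => q % (d+1) = (k.succ).val)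
        = (Q.filter (fun q => q % d = k.val)).image (phi d) := by
      ext q
      simp only [Finset.mem_filter, Finset.mem_insert, Finset.mem_image, Fin.val_succ]
      constructor
      · rintro ⟨rfl | ⟨p, hp, rfl⟩, h⟩
        · simp at h
        · rw [phi_mod hd] at h
          exact ⟨p, ⟨hp, by omega⟩, rfl⟩
      · rintro ⟨p, ⟨hp, h⟩, rfl⟩
        exact ⟨Or.inr ⟨p, hp, rfl⟩, by rw [phi_mod hd, h]⟩
    rw [this, Finset.sum_image (fun a _ b _ h => (phi_strictMono d).injective h)]
    exact Finset.sum_congr rfl (fun q _ => phi_div hd q)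

/-- The orbit of zero. -/
noncomputable def orb (d : ℕ) (a : Fin d → ℕ) : Fin d → ℕ := gIter d a (fun _ => 0)

lemma gOp_iter_cons {d : ℕ} (j m : ℕ) (y : Fin d → ℕ) :
    (gOp (d+1) (j+2))^[m] (Fin.cons 0 y) = Fin.cons 0 ((gOp d (j+1))^[m] y) := by
  induction m generalizing y with
  | zero => rfl
  | succ m ih => rw [Function.iterate_succ_apply, Function.iterate_succ_apply, gOp_cons, ih]

lemma orb_succ {d : ℕ} (a : Fin (d+1) → ℕ) :
    orb (d+1) a = rotT^[a 0] (Fin.cons 0 (orb d (fun i => a i.succ))) := by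
  have h1 : (gOp (d+1) 1) = rotT := funext gOp_one
  have key : ∀ (l : List (Fin d)) (y : Fin d → ℕ),
      (l.foldr (fun j z => (gOp (d+1) (j.succ.val + 1))^[a j.succ] z)
        (Fin.cons 0 y : Fin (d+1) → ℕ))
      = Fin.cons 0 (l.foldr (fun j z => (gOp d (j.val + 1))^[a j.succ] z) y) := by
    intro l y
    induction l with
    | nil => rfl
    | cons j l ih =>
      rw [List.foldr_cons, List.foldr_cons, ih]
      exact gOp_iter_cons _ _ _
  have h0 : (fun _ => 0 : Fin (d+1) → ℕ) = Fin.cons 0 (fun _ : Fin d => 0) := by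
    funext i
    refine Fin.cases rfl (fun k => rfl) i
  unfold orb gIter
  rw [List.finRange_succ, List.foldr_cons, List.foldr_map, h0, key]
  simp only [Fin.val_zero, zero_add, h1]

lemma size_rotT {d : ℕ} (x : Fin (d+1) → ℕ) : size (rotT x) = size x + 1 := by
  unfold size
  rw [Fin.sum_univ_succ, Fin.sum_univ_castSucc]
  simp only [rotT, Fin.cons_zero, Fin.cons_succ]
  ring

lemma weight_cons {d : ℕ} (a : ℕ) (y : Fin d → ℕ) :
    weight (Fin.cons a y : Fin (d+1) → ℕ) = ∑ j, ((y j - a) + (a - y j - 1)) + weight y := by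
  unfold weight
  rw [Fin.sum_univ_succ]
  congr 1
  · rw [Fin.sum_univ_succ]
    simp
  · apply Finset.sum_congr rfl
    intro i _
    rw [Fin.sum_univ_succ]
    simp

lemma weight_last {d : ℕ} (x : Fin (d+1) → ℕ) :
    weight x = ∑ j : Fin d, ((x (Fin.last d) - x j.castSucc) + (x j.castSucc - x (Fin.last d) - 1))
      + weight (fun i : Fin d => x i.castSucc) := by
  unfold weight
  rw [Fin.sum_univ_castSucc]
  have : (∑ j : Fin (d+1), if Fin.last d < j then
      (x j - x (Fin.last d)) + (x (Fin.last d) - x j - 1) else 0) = 0 := by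
    apply Finset.sum_eq_zero
    intro j _
    rw [if_neg (not_lt.2 (Fin.le_last j))]
  rw [this, add_zero, ← Finset.sum_add_distrib]
  apply Finset.sum_congr rfl
  intro i _
  rw [Fin.sum_univ_castSucc, add_comm]
  simp [Fin.castSucc_lt_last]

lemma weight_rotT {d : ℕ} (x : Fin (d+1) → ℕ) : weight (rotT x) = weight x := by
  rw [weight_last x, rotT, weight_cons]
  congr 1
  apply Finset.sum_congr rfl
  intro i _
  omega

lemma size_iter {d : ℕ} (m : ℕ) (x : Fin (d+1) → ℕ) : size (rotT^[m] x) = size x + m := by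
  induction m with
  | zero => rfl
  | succ m ih => rw [Function.iterate_succ_apply', size_rotT, ih, add_assoc]

lemma weight_iter {d : ℕ} (m : ℕ) (x : Fin (d+1) → ℕ) : weight (rotT^[m] x) = weight x := by
  induction m with
  | zero => rfl
  | succ m ih => rw [Function.iterate_succ_apply', weight_rotT, ih]

lemma size_cons {d : ℕ} (y : Fin d → ℕ) : size (Fin.cons 0 y : Fin (d+1) → ℕ) = size y := by
  unfold size
  rw [Fin.sum_univ_succ]
  simp

lemma size_orb {d : ℕ} (a : Fin d → ℕ) : size (orb d a) = ∑ i, a i := by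
  induction d with
  | zero => simp [size]
  | succ d ih => rw [orb_succ, size_iter, size_cons, ih, Fin.sum_univ_succ, add_comm]

lemma weight_orb {d : ℕ} (a : Fin d → ℕ) : weight (orb d a) = ∑ i, a i * i.val := by
  induction d with
  | zero => simp [weight]
  | succ d ih =>
    rw [orb_succ, weight_iter, weight_cons, ih, Fin.sum_univ_succ]
    have := size_orb (fun i : Fin d => a i.succ)
    unfold size at this
    simp only [Nat.sub_zero, Nat.zero_sub, add_zero, this, Fin.val_zero, mul_zero, zero_add,
      Fin.val_succ, mul_add, mul_one, Finset.sum_add_distrib]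
    ring

lemma rotT_inj {d : ℕ} : Function.Injective (rotT : (Fin (d+1) → ℕ) → _) := by
  intro x y h
  rw [rotT, rotT, Fin.cons_inj] at h
  funext i
  refine Fin.lastCases ?_ (fun k => ?_) i
  · exact Nat.succ.inj h.1
  · exact congrFun h.2 k

lemma rotT_iter_inj {d : ℕ} (m m' : ℕ) (y y' : Fin d → ℕ)
    (h : rotT^[m] (Fin.cons 0 y : Fin (d+1) → ℕ) = rotT^[m'] (Fin.cons 0 y')) :
    m = m' ∧ y = y' := by
  induction m generalizing m' with
  | zero =>
    cases m' with
    | zero => exact ⟨rfl, ((Fin.cons_inj).1 h).2⟩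
    | succ m' =>
      rw [Function.iterate_succ_apply'] at h
      have := congrFun h 0
      simp [rotT] at this
  | succ m ih =>
    cases m' with
    | zero =>
      rw [Function.iterate_succ_apply'] at h
      have := congrFun h 0
      simp [rotT] at this
    | succ m' =>
      rw [Function.iterate_succ_apply', Function.iterate_succ_apply'] at h
      obtain ⟨h1, h2⟩ := ih m' (rotT_inj h)
      exact ⟨by rw [h1], h2⟩

lemma rotT_iter_surj {d : ℕ} (s : ℕ) (x : Fin (d+1) → ℕ) (hx : size x = s) :
    ∃ m y, rotT^[m] (Fin.cons 0 y : Fin (d+1) → ℕ) = x := by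
  induction s generalizing x with
  | zero =>
    refine ⟨0, fun i => x i.succ, ?_⟩
    have : x 0 = 0 := by
      unfold size at hx
      rw [Finset.sum_eq_zero_iff] at hx
      exact hx 0 (Finset.mem_univ _)
    have h := Fin.cons_self_tail x
    rw [this] at h
    exact h
  | succ s ih =>
    cases h0 : x 0 with
    | zero =>
      refine ⟨0, fun i => x i.succ, ?_⟩
      have h := Fin.cons_self_tail x
      rw [h0] at h
      exact h
    | succ k =>
      set z : Fin (d+1) → ℕ := Fin.snoc (fun i : Fin d => x i.succ) k with hz
      have hzx : rotT z = x := by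
        funext i
        refine Fin.cases ?_ (fun j => ?_) i
        · simp [rotT, hz, h0]
        · simp [rotT, hz]
      obtain ⟨m, y, h⟩ := ih z (by
        have := size_rotT z
        rw [hzx] at this
        omega)
      exact ⟨m + 1, y, by rw [Function.iterate_succ_apply', h, hzx]⟩

lemma orb_inj {d : ℕ} (a b : Fin d → ℕ) (h : orb d a = orb d b) : a = b := by
  induction d with
  | zero => exact Subsingleton.elim _ _
  | succ d ih =>
    rw [orb_succ, orb_succ] at h
    obtain ⟨h1, h2⟩ := rotT_iter_inj _ _ _ _ h
    have h3 := ih _ _ h2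
    funext i
    exact Fin.cases h1 (fun k => congrFun h3 k) i

lemma orb_surj {d : ℕ} (x : Fin d → ℕ) : ∃ a, orb d a = x := by
  induction d with
  | zero => exact ⟨x, Subsingleton.elim _ _⟩
  | succ d ih =>
    obtain ⟨m, y, h⟩ := rotT_iter_surj _ x rfl
    obtain ⟨b, hb⟩ := ih y
    refine ⟨Fin.cons m b, ?_⟩
    rw [orb_succ]
    simp only [Fin.cons_zero, Fin.cons_succ]
    rw [show (fun i => b i) = b from rfl, hb, h]

lemma count_sum_card {d W : ℕ} (P : Nat.Partition W) (hP : ∀ p ∈ P.parts, p ≤ d - 1) :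
    ∑ k ∈ Finset.Icc 1 (d - 1), P.parts.count k = P.parts.card := by
  apply Multiset.sum_count_eq_card
  intro p hp
  exact Finset.mem_Icc.2 ⟨P.parts_pos hp, hP p hp⟩

end Spiral

open Spiral in
/-- Fix `n, W ∈ ℕ`. The map sending a partition `λ` with `|λ| = W`, at most
`n` parts, each part of size at most `d − 1`, written as `[1]^{m₁}⋯[d−1]^{m_{d−1}}` (where
`m_i` is the number of parts of `λ` equal to `i`), to
`g₁^{n − Σ_{i=1}^{d−1} m_i} ∘ g₂^{m₁} ∘ ⋯ ∘ g_d^{m_{d−1}}(0,…,0) ∈ ℕ^d`, is a bijection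
onto `{x ∈ ℕ^d : n(x) = n ∧ W(x) = W}`. (In `gIter`, the exponent vector `a` has
`a 0 = n − Σ_{i=1}^{d-1} m_i` for `g₁` and `a i = m_i` for `g_{i+1}`, `1 ≤ i ≤ d-1`.) -/
theorem statement10 (d : ℕ) (hd : 1 ≤ d) (n W : ℕ) :
    Set.BijOn
      (fun P : Nat.Partition W =>
        gIter d
          (fun i => if i.val = 0 then n - ∑ k ∈ Finset.Icc 1 (d - 1), P.parts.count k
            else P.parts.count i.val)
          (fun _ => 0))
      {P : Nat.Partition W | P.parts.card ≤ n ∧ ∀ p ∈ P.parts, p ≤ d - 1}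
      {x : Fin d → ℕ | size x = n ∧ weight x = W} := by
  obtain ⟨e, rfl⟩ : ∃ e, d = e + 1 := ⟨d - 1, by omega⟩
  simp only [Nat.add_sub_cancel]
  have hcard : ∀ P : Nat.Partition W, (∀ p ∈ P.parts, p ≤ e) →
      ∑ k ∈ Finset.Icc 1 e, P.parts.count k = P.parts.card := fun P hP =>
    count_sum_card (d := e + 1) P hP
  have hIcc : ∀ f : ℕ → ℕ, ∑ k ∈ Finset.Icc 1 e, f k = ∑ i : Fin e, f (i.val + 1) := by
    intro f
    rw [Fin.sum_univ_eq_sum_range (fun i => f (i + 1)) e, Finset.range_eq_Ico,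
      Finset.sum_Ico_add' f 0 e 1]
    rfl
  refine ⟨?_, ?_, ?_⟩
  · rintro P ⟨h1, h2⟩
    change size (orb (e+1) _) = n ∧ weight (orb (e+1) _) = W
    rw [size_orb, weight_orb, Fin.sum_univ_succ, Fin.sum_univ_succ]
    simp only [Fin.val_zero, if_true, Fin.val_succ, Nat.succ_ne_zero, if_false, mul_zero, zero_add]
    rw [← hIcc (fun k => P.parts.count k), ← hIcc (fun k => P.parts.count k * k), hcard P h2]
    refine ⟨by omega, ?_⟩
    conv_rhs => rw [← P.parts_sum, Finset.sum_multiset_count]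
    simp only [smul_eq_mul]
    symm
    apply Finset.sum_subset
    · intro p hp
      rw [Multiset.mem_toFinset] at hp
      exact Finset.mem_Icc.2 ⟨P.parts_pos hp, h2 p hp⟩
    · intro p _ hp
      rw [Multiset.mem_toFinset] at hp
      rw [Multiset.count_eq_zero_of_notMem hp, zero_mul]
  · rintro P ⟨h1, h2⟩ P' ⟨h1', h2'⟩ h
    have h3 := orb_inj _ _ h
    apply Nat.Partition.ext
    ext k
    rcases Nat.eq_zero_or_pos k with rfl | hk
    · rw [Multiset.count_eq_zero_of_notMem (fun hm => lt_irrefl _ (P.parts_pos hm)),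
        Multiset.count_eq_zero_of_notMem (fun hm => lt_irrefl _ (P'.parts_pos hm))]
    · by_cases hke : k ≤ e
      · have := congrFun h3 ⟨k, by omega⟩
        simpa [hk.ne'] using this
      · rw [Multiset.count_eq_zero_of_notMem (fun hm => hke (h2 _ hm)),
          Multiset.count_eq_zero_of_notMem (fun hm => hke (h2' _ hm))]
  · rintro x ⟨h1, h2⟩
    obtain ⟨a, rfl⟩ := orb_surj x
    rw [size_orb] at h1
    rw [weight_orb] at h2
    set s : Multiset ℕ := ∑ i : Fin (e+1), Multiset.replicate (a i) i.val with hs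
    have hsum : s.sum = W := by
      rw [hs, ← h2, Multiset.sum_sum]
      simp
    have hcount : ∀ i : Fin (e+1), s.count i.val = a i := by
      intro i
      rw [hs, Multiset.count_sum']
      simp only [Multiset.count_replicate, Fin.val_inj]
      simp
    have hle : ∀ p ∈ s, p ≤ e := by
      intro p hp
      rw [hs, Multiset.mem_sum] at hp
      obtain ⟨i, -, hi⟩ := hp
      rw [Multiset.eq_of_mem_replicate hi]
      omega
    let P := Nat.Partition.ofSums W s hsum
    have hPle : ∀ p ∈ P.parts, p ≤ e := by
      intro p hp
      exact hle p (Multiset.mem_of_mem_filter hp)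
    have hPc : ∀ i : Fin e, P.parts.count (i.val + 1) = a i.succ := by
      intro i
      rw [← hcount i.succ]
      exact Nat.Partition.count_ofSums_of_ne_zero hsum (Nat.succ_ne_zero _)
    have hPcard : P.parts.card = ∑ i : Fin e, a i.succ := by
      rw [← hcard P hPle, hIcc (fun k => P.parts.count k)]
      exact Finset.sum_congr rfl (fun i _ => hPc i)
    rw [Fin.sum_univ_succ] at h1
    refine ⟨P, ⟨by omega, hPle⟩, ?_⟩
    change orb (e+1) _ = _
    congr 1
    funext i
    refine Fin.cases ?_ (fun k => ?_) i
    · simp only [Fin.val_zero, if_true]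
      rw [hcard P hPle]
      omega
    · simp only [Fin.val_succ, Nat.succ_ne_zero, if_false]
      exact hPc k
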